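/- arXiv:1003.2362 — 3 statements merged into one kernel-verified Lean document; each statement's English description precedes it below -/
import Mathlib

section
/- Let {A_q}_{q∈ℕ} be a sequence of measurable subsets of [0,1)^d with ∑_{r=1}^∞ μ_d(A_r) = ∞. Then the set of pairs (x,γ) ∈ [0,1)^d × [0,1)^d such that there exist infinitely many q ∈ ℕ and p ∈ ℤ^d with q·x − γ − p ∈ A_q has full 2d-dimensional Lebesgue measure (measure 1). -/
open MeasureTheory ProbabilityTheory Filter Topology

lemma bc {Ω : Type*} [MeasurableSpace Ω] (μ : Measure Ω) [IsProbabilityMeasure μ]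
    (F : ℕ → Set Ω) (hF : ∀ q, MeasurableSet (F q))
    (hind : ∀ q r, q ≠ r → IndepFun ((F q).indicator (fun _ => (1:ℝ)))
      ((F r).indicator (fun _ => (1:ℝ))) μ)
    (hdiv : ∑' q, μ (F q) = ⊤) : ∀ᵐ ω ∂μ, {q | ω ∈ F q}.Infinite := by
  set X : ℕ → Ω → ℝ := fun q => (F q).indicator (fun _ => (1:ℝ)) with hX
  have hL : ∀ q, MemLp (X q) 2 μ := fun q =>
    (memLp_const (1:ℝ)).indicator (hF q)
  have hE : ∀ q, ∫ ω, X q ω ∂μ = μ.real (F q) := fun q => by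
    simp [hX, integral_indicator_const _ (hF q)]
  have hsq : ∀ q, X q ^ 2 = X q := fun q => by
    ext ω; by_cases h : ω ∈ F q <;> simp [hX, h]
  have hV : ∀ q, variance (X q) μ ≤ μ.real (F q) := fun q => by
    have := variance_le_expectation_sq (hL q).1
    rwa [hsq, hE] at this
  set m : ℕ → ℝ := fun n => ∑ q ∈ Finset.range n, μ.real (F q) with hm
  have hmt : Tendsto m atTop atTop := by
    apply (not_summable_iff_tendsto_nat_atTop_of_nonneg (fun _ => measureReal_nonneg)).1
    intro hs
    have h1 := hs.tsum_ofReal_ne_top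
    apply h1
    rw [← hdiv]
    congr 1
    ext q
    exact ofReal_measureReal
  have hSE : ∀ n, ∫ ω, (∑ q ∈ Finset.range n, X q) ω ∂μ = m n := fun n => by
    simp only [Finset.sum_apply]
    rw [integral_finsetSum _ fun q _ => (hL q).integrable (by norm_num)]
    simp [hE, hm]
  have hSV : ∀ n, variance (∑ q ∈ Finset.range n, X q) μ ≤ m n := fun n => by
    rw [IndepFun.variance_sum (fun q _ => hL q) (fun q _ r _ h => hind q r h)]
    exact Finset.sum_le_sum fun q _ => hV q
  have hP : ∀ n, 0 < m n → μ {ω | (∑ q ∈ Finset.range n, X q) ω ≤ m n / 2}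
      ≤ ENNReal.ofReal (4 / m n) := fun n hn => by
    have h := meas_ge_le_variance_div_sq
      (memLp_finsetSum' (Finset.range n) (fun q _ => hL q)) (half_pos hn)
    rw [hSE] at h
    refine (measure_mono ?_).trans (h.trans (ENNReal.ofReal_le_ofReal ?_))
    · intro ω hω
      simp only [Set.mem_ofPred_eq] at hω ⊢
      rw [abs_sub_comm]
      exact le_trans (by linarith) (le_abs_self _)
    · calc _ ≤ m n / (m n / 2) ^ 2 := by gcongr; exact hSV n
        _ = 4 / m n := by field_simp; norm_num
  have hK : ∀ K : ℕ, μ {ω | ∀ n, (∑ q ∈ Finset.range n, X q) ω ≤ K} = 0 := fun K => by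
    have hlim : Tendsto (fun n => ENNReal.ofReal (4 / m n)) atTop (𝓝 0) := by
      rw [← ENNReal.ofReal_zero]
      exact ENNReal.tendsto_ofReal (hmt.const_div_atTop 4)
    refine le_antisymm (ge_of_tendsto hlim ?_) (zero_le)
    filter_upwards [hmt.eventually_gt_atTop 0, hmt.eventually_ge_atTop (2 * K)] with n h0 h1
    refine (measure_mono ?_).trans (hP n h0)
    intro ω hω
    have := hω n
    simp only [Set.mem_ofPred_eq]
    linarith
  have hU : μ (⋃ K : ℕ, {ω | ∀ n, (∑ q ∈ Finset.range n, X q) ω ≤ K}) = 0 :=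
    measure_iUnion_null hK
  rw [ae_iff]
  refine measure_mono_null ?_ hU
  intro ω hω
  simp only [Set.mem_ofPred_eq, Set.not_infinite] at hω
  refine Set.mem_iUnion.2 ⟨hω.toFinset.card, fun n => ?_⟩
  classical
  rw [Finset.sum_apply]
  calc ∑ q ∈ Finset.range n, X q ω = ∑ q ∈ Finset.range n, if q ∈ hω.toFinset then (1:ℝ) else 0 := by
        refine Finset.sum_congr rfl fun q _ => ?_
        simp [hX, Set.indicator_apply]
    _ = (((Finset.range n).filter (· ∈ hω.toFinset)).card : ℝ) := by simp
    _ ≤ _ := by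
      exact_mod_cast Finset.card_le_card (fun q hq => (Finset.mem_filter.1 hq).2)

abbrev TT (d : ℕ) := Fin d → UnitAddCircle

instance : IsProbabilityMeasure (volume : Measure UnitAddCircle) := ⟨UnitAddCircle.measure_univ⟩

instance (d : ℕ) : IsProbabilityMeasure (volume : Measure (TT d)) := by
  rw [volume_pi]; infer_instance

instance (d : ℕ) : Measure.IsAddHaarMeasure (volume : Measure (TT d)) := by
  rw [volume_pi]; infer_instance

lemma pairMP (d : ℕ) (q r : ℕ) (h : q ≠ r) :
    MeasurePreserving (fun z : TT d × TT d => (q • z.1 - z.2, r • z.1 - z.2))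
      ((volume : Measure (TT d)).prod volume) ((volume : Measure (TT d)).prod volume) := by
  let f : TT d × TT d →+ TT d × TT d :=
    { toFun := fun z => (q • z.1 - z.2, r • z.1 - z.2)
      map_zero' := by simp
      map_add' := fun a b => by
        ext1 <;> simp only [Prod.fst_add, Prod.snd_add, smul_add] <;> abel }
  have hc : Continuous f := by
    change Continuous (fun z : TT d × TT d => (q • z.1 - z.2, r • z.1 - z.2))
    fun_prop
  have hs : Function.Surjective f := by
    rintro ⟨a, b⟩
    have hn : ((q : ℤ) - r) ≠ 0 := by omega
    let x : TT d := fun i => DivisibleBy.div (a i - b i) ((q : ℤ) - r)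
    have hx : q • x - r • x = a - b := by
      ext i
      have := DivisibleBy.div_cancel (a i - b i) hn
      rw [sub_smul, natCast_zsmul, natCast_zsmul] at this
      simpa [x] using this
    refine ⟨(x, q • x - a), ?_⟩
    change (q • x - (q • x - a), r • x - (q • x - a)) = (a, b)
    ext1
    · simp
    · have : r • x - (q • x - a) = a - (q • x - r • x) := by abel
      simp only [this, hx]; abel
  haveI : Measure.IsAddHaarMeasure ((volume : Measure (TT d)).prod (volume : Measure (TT d))) :=
    Measure.prod.instIsAddHaarMeasure _ _
  exact f.measurePreserving hc hs rfl

lemma singleMP (d : ℕ) (q : ℕ) :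
    MeasurePreserving (fun z : TT d × TT d => q • z.1 - z.2)
      ((volume : Measure (TT d)).prod volume) (volume : Measure (TT d)) :=
  (measurePreserving_fst (μ := (volume : Measure (TT d))) (ν := (volume : Measure (TT d)))).comp
    (pairMP d q (q + 1) (by omega))

lemma torus (d : ℕ) (B : ℕ → Set (TT d)) (hB : ∀ q, MeasurableSet (B q))
    (hdiv : ∑' q, volume (B q) = ⊤) :
    ∀ᵐ z ∂((volume : Measure (TT d)).prod volume), {q : ℕ | q • z.1 - z.2 ∈ B q}.Infinite := by
  refine bc _ (fun q => (fun z : TT d × TT d => q • z.1 - z.2) ⁻¹' B q)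
    (fun q => (singleMP d q).measurable (hB q)) ?_ ?_
  · intro q r h
    have hi : IndepFun (fun z : TT d × TT d => q • z.1 - z.2) (fun z => r • z.1 - z.2)
        ((volume : Measure (TT d)).prod volume) := by
      rw [indepFun_iff_map_prod_eq_prod_map_map (singleMP d q).measurable.aemeasurable
        (singleMP d r).measurable.aemeasurable, (singleMP d q).map_eq, (singleMP d r).map_eq]
      exact (pairMP d q r h).map_eq
    exact hi.comp (φ := (B q).indicator (fun _ => (1:ℝ))) (ψ := (B r).indicator (fun _ => (1:ℝ)))
      (measurable_const.indicator (hB q)) (measurable_const.indicator (hB r))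
  · rw [← hdiv]
    congr 1
    ext q
    exact (singleMP d q).measure_preimage (hB q).nullMeasurableSet

abbrev CC (d : ℕ) : Set (Fin d → ℝ) := Set.univ.pi fun _ => Set.Ico (0 : ℝ) 1

def pr (d : ℕ) (x : Fin d → ℝ) : TT d := fun i => (x i : UnitAddCircle)

lemma prMP (d : ℕ) : MeasurePreserving (pr d) (volume.restrict (CC d)) volume := by
  rw [volume_pi, Measure.restrict_pi_pi]
  refine measurePreserving_pi _ _ (fun i => ?_)
  have := AddCircle.measurePreserving_mk 1 0
  rw [zero_add] at this
  rwa [Measure.restrict_congr_set (Ico_ae_eq_Ioc (a := (0:ℝ)) (b := 1) (μ := volume))]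

noncomputable def rep (d : ℕ) (y : TT d) : Fin d → ℝ :=
  fun i => (AddCircle.measurableEquivIco 1 0 (y i) : ℝ)

lemma rep_meas (d : ℕ) : Measurable (rep d) := by
  refine measurable_pi_lambda _ fun i => ?_
  exact measurable_subtype_coe.comp
    ((AddCircle.measurableEquivIco 1 0).measurable.comp (measurable_pi_apply i))

lemma rep_pr (d : ℕ) (x : Fin d → ℝ) : rep d (pr d x) = fun i => Int.fract (x i) := by
  ext i
  have := AddCircle.coe_equivIco_mk_apply (1:ℝ) (x i)
  rw [div_one, mul_one] at this
  exact this

lemma rep_pr_mem (d : ℕ) (x : Fin d → ℝ) (hx : x ∈ CC d) : rep d (pr d x) = x := by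
  rw [rep_pr]
  ext i
  exact Int.fract_eq_self.2 (hx i trivial)

theorem stmt5 (d : ℕ) (A : ℕ → Set (Fin d → ℝ))
    (hA : ∀ q, MeasurableSet (A q))
    (hsub : ∀ q, A q ⊆ Set.univ.pi fun _ => Set.Ico (0 : ℝ) 1)
    (hdiv : ∑' r : ℕ, volume (A r) = ⊤) :
    volume {p : (Fin d → ℝ) × (Fin d → ℝ) |
      p.1 ∈ (Set.univ.pi fun _ => Set.Ico (0 : ℝ) 1) ∧
      p.2 ∈ (Set.univ.pi fun _ => Set.Ico (0 : ℝ) 1) ∧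
      {q : ℕ | ∃ v : Fin d → ℤ,
        ((q : ℝ) • p.1 - p.2 - fun t => (v t : ℝ)) ∈ A q}.Infinite} = 1 := by
  have hCm : MeasurableSet (CC d) := MeasurableSet.univ_pi fun _ => measurableSet_Ico
  have hC1 : volume (CC d) = 1 := by simp [CC, volume_pi_pi]
  have hBm : ∀ q, MeasurableSet (rep d ⁻¹' A q) := fun q => rep_meas d (hA q)
  have hBv : ∀ q, volume (rep d ⁻¹' A q) = volume (A q) := fun q => by
    rw [← (prMP d).measure_preimage (hBm q).nullMeasurableSet,
      Measure.restrict_apply ((prMP d).measurable (hBm q))]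
    congr 1
    ext x
    constructor
    · rintro ⟨h1, h2⟩
      simpa [rep_pr_mem d x h2] using h1
    · intro h
      exact ⟨by simpa [rep_pr_mem d x (hsub q h)] using h, hsub q h⟩
  have ht := torus d (fun q => rep d ⁻¹' A q) hBm (by simpa only [hBv] using hdiv)
  have hmp := (prMP d).prod (prMP d)
  have ht2 := hmp.quasiMeasurePreserving.ae ht
  rw [Measure.prod_restrict, ← Measure.volume_eq_prod, ae_restrict_iff' (hCm.prod hCm)] at ht2
  have hfin : volume (CC d ×ˢ CC d) = 1 := by
    rw [Measure.volume_eq_prod, Measure.prod_prod, hC1, one_mul]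
  rw [← hfin]
  refine measure_congr ?_
  filter_upwards [ht2] with p hp
  refine propext ⟨fun h => ⟨h.1, h.2.1⟩, fun h => ⟨h.1, h.2, (hp h).mono ?_⟩⟩
  intro q hq
  have he : q • pr d p.1 - pr d p.2 = pr d ((q : ℝ) • p.1 - p.2) := by
    ext i
    simp [pr, ← nsmul_eq_mul]
  have hq' : rep d (q • pr d p.1 - pr d p.2) ∈ A q := hq
  rw [he, rep_pr] at hq'
  exact ⟨fun i => ⌊((q : ℝ) • p.1 - p.2) i⌋, hq'⟩
end

section
/- Fix reals i, j > 0 with i + j = 1 and x ∈ Bad(i,j). Then the set Bad^x(i,j), consisting of γ ∈ [0,1]² for which there exists c(γ) > 0 such that max{‖q x₁ − γ₁‖^{1/i}, ‖q x₂ − γ₂‖^{1/j}} > c(γ)/|q| for all nonzero integers q, has Hausdorff dimension 2. -/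
open MeasureTheory Set Filter

/-- Distance to the nearest integer. -/
noncomputable def nint (y : ℝ) : ℝ := |y - (round y : ℝ)|

/-- `pw y e = y ^ (1/e)`, with the convention that `y ^ (1/0) = 0`. -/
noncomputable def pw (y e : ℝ) : ℝ := if e = 0 then 0 else y ^ (1 / e)

/-- A vector is irrational if `1, x₁, x₂` are linearly independent over `ℚ`. -/
def IrrVec (x : ℝ × ℝ) : Prop :=
  ∀ a b c : ℤ, (a : ℝ) * x.1 + (b : ℝ) * x.2 + (c : ℝ) = 0 → a = 0 ∧ b = 0 ∧ c = 0

/-- The set `Bad(i,j)` of `(i,j)`-badly approximable vectors. -/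
def Badij (i j : ℝ) (x : ℝ × ℝ) : Prop :=
  IrrVec x ∧ ∃ c > (0 : ℝ), ∀ q : ℕ, 0 < q →
    max (pw (nint (q * x.1)) i) (pw (nint (q * x.2)) j) > c / q

/-- The twisted well-approximable set `W^x_{(i,j)}(ψ)`. -/
def twistedW (x : ℝ × ℝ) (i j : ℝ) (ψ : ℕ → ℝ) : Set (ℝ × ℝ) :=
  {γ ∈ Set.Icc (0 : ℝ × ℝ) 1 |
    {q : ℤ | q ≠ 0 ∧
      max (pw (nint (q * x.1 - γ.1)) i) (pw (nint (q * x.2 - γ.2)) j)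
        ≤ ψ q.natAbs}.Infinite}


noncomputable def cpos {M : ℕ} (child : ℕ → ℕ × ℕ → Fin M → ℕ × ℕ) (ω : ℕ → Fin M) : ℕ → ℕ × ℕ
  | 0 => (0, 0)
  | n + 1 => child n (cpos child ω n) (ω n)

theorem cpos_measurable {M : ℕ} (child : ℕ → ℕ × ℕ → Fin M → ℕ × ℕ) (n : ℕ) :
    Measurable (fun ω : ℕ → Fin M => cpos child ω n) := by
  induction n with
  | zero => simp only [cpos]; exact measurable_const
  | succ n ih =>
    simp only [cpos]
    have : Measurable (fun z : (ℕ × ℕ) × Fin M => child n z.1 z.2) := Measurable.of_discrete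
    exact this.comp (ih.prodMk (measurable_pi_apply n))

theorem cpos_inj {M : ℕ} (child : ℕ → ℕ × ℕ → Fin M → ℕ × ℕ) (s t : ℕ → ℕ)
    (hinj : ∀ n p, Function.Injective (child n p))
    (h1 : ∀ n p τ, (child n p τ).1 / s n = p.1) (h2 : ∀ n p τ, (child n p τ).2 / t n = p.2)
    (ω ω' : ℕ → Fin M) (n : ℕ) (h : cpos child ω n = cpos child ω' n) :
    ∀ m < n, ω m = ω' m := by
  induction n with
  | zero => intro m hm; omega
  | succ n ih =>
    simp only [cpos] at h
    have e : cpos child ω n = cpos child ω' n := by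
      ext
      · rw [← h1 n (cpos child ω n) (ω n), h, h1]
      · rw [← h2 n (cpos child ω n) (ω n), h, h2]
    intro m hm
    rcases Nat.lt_succ_iff_lt_or_eq.1 hm with h' | rfl
    · exact ih e m h'
    · rw [e] at h
      exact hinj _ _ h

theorem nested_real (A s a : ℕ → ℕ) (hA0 : A 0 = 1) (hA : ∀ n, A (n + 1) = A n * s n)
    (hs : ∀ n, 0 < s n) (ha : ∀ n, a (n + 1) / s n = a n) (n : ℕ) :
    (⨆ n, (a n : ℝ) / A n) ∈ Icc ((a n : ℝ) / A n) ((a n + 1 : ℝ) / A n) := by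
  have hAp : ∀ n, 0 < A n := by
    intro n
    induction n with
    | zero => omega
    | succ n ih => rw [hA]; exact Nat.mul_pos ih (hs n)
  have hlo : Monotone (fun n => (a n : ℝ) / A n) := by
    refine monotone_nat_of_le_succ fun n => ?_
    have e1 : (0:ℝ) < A n := by exact_mod_cast hAp n
    have e2 : (0:ℝ) < s n := by exact_mod_cast hs n
    have := Nat.div_mul_le_self (a (n+1)) (s n)
    rw [ha] at this
    have h' : (a n * s n : ℝ) ≤ a (n+1) := by exact_mod_cast this
    rw [hA]; push_cast
    rw [div_le_div_iff₀ e1 (by positivity)]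
    nlinarith
  have hup : Antitone (fun n => (a n + 1 : ℝ) / A n) := by
    refine antitone_nat_of_succ_le fun n => ?_
    have e1 : (0:ℝ) < A n := by exact_mod_cast hAp n
    have e2 : (0:ℝ) < s n := by exact_mod_cast hs n
    have := Nat.lt_div_mul_add (a := a (n+1)) (hs n)
    rw [ha] at this
    have h' : (a (n+1) + 1 : ℝ) ≤ a n * s n + s n := by exact_mod_cast this
    rw [hA]; push_cast
    rw [div_le_div_iff₀ (by positivity) e1]
    nlinarith
  have := hlo.ciSup_mem_iInter_Icc_of_antitone hup (fun n => by
    have e1 : (0:ℝ) < A n := by exact_mod_cast hAp n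
    show (a n : ℝ) / A n ≤ (a n + 1 : ℝ) / A n
    gcongr; linarith)
  exact mem_iInter.1 this n

theorem count_nat (x L : ℝ) (hL : 0 ≤ L) : ∃ F : Finset ℕ, (F.card : ℝ) ≤ L + 1 ∧
    ∀ u : ℕ, x ≤ u → u ≤ x + L → u ∈ F := by
  refine ⟨Finset.Icc ⌈x⌉₊ (⌈x⌉₊ + ⌊L⌋₊), ?_, ?_⟩
  · simp only [Nat.card_Icc]
    have : ⌈x⌉₊ + ⌊L⌋₊ + 1 - ⌈x⌉₊ = ⌊L⌋₊ + 1 := by omega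
    rw [this]; push_cast
    have := Nat.floor_le hL
    linarith
  · intro u h1 h2
    have h3 : ⌈x⌉₊ ≤ u := Nat.ceil_le.2 h1
    rw [Finset.mem_Icc]
    refine ⟨h3, ?_⟩
    have : u - ⌈x⌉₊ ≤ ⌊L⌋₊ := by
      apply Nat.le_floor
      rw [Nat.cast_sub h3]
      have := Nat.le_ceil x
      linarith
    omega

noncomputable def cmeas (M : ℕ) [NeZero M] : Measure (ℕ → Fin M) :=
  Measure.infinitePi (fun _ : ℕ => (PMF.uniformOfFintype (Fin M)).toMeasure)

instance (M : ℕ) [NeZero M] : IsProbabilityMeasure (cmeas M) := by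
  unfold cmeas; infer_instance

theorem cmeas_cyl (M : ℕ) [NeZero M] (ω0 : ℕ → Fin M) (n : ℕ) :
    cmeas M {ω | ∀ m < n, ω m = ω0 m} = ((M : ENNReal)⁻¹) ^ n := by
  have : {ω : ℕ → Fin M | ∀ m < n, ω m = ω0 m} =
      Set.pi (Finset.range n : Set ℕ) (fun m => {ω0 m}) := by
    ext ω; simp [Set.mem_pi]
  rw [this, cmeas, Measure.infinitePi_pi]
  · simp [PMF.uniformOfFintype_apply]
  · intros; exact measurableSet_singleton _

noncomputable def cpi {M : ℕ} (child : ℕ → ℕ × ℕ → Fin M → ℕ × ℕ) (A B : ℕ → ℕ)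
    (ω : ℕ → Fin M) : ℝ × ℝ :=
  (⨆ n, ((cpos child ω n).1 : ℝ) / A n, ⨆ n, ((cpos child ω n).2 : ℝ) / B n)

theorem cpi_measurable {M : ℕ} (child : ℕ → ℕ × ℕ → Fin M → ℕ × ℕ) (A B : ℕ → ℕ) :
    Measurable (cpi child A B) := by
  unfold cpi
  refine Measurable.prodMk (Measurable.iSup fun n => ?_) (Measurable.iSup fun n => ?_)
  · have : Measurable (fun p : ℕ × ℕ => (p.1 : ℝ) / A n) := Measurable.of_discrete
    exact this.comp (cpos_measurable child n)
  · have : Measurable (fun p : ℕ × ℕ => (p.2 : ℝ) / B n) := Measurable.of_discrete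
    exact this.comp (cpos_measurable child n)

theorem cmeas_pos {M : ℕ} [NeZero M] (child : ℕ → ℕ × ℕ → Fin M → ℕ × ℕ) (s t : ℕ → ℕ)
    (hinj : ∀ n p, Function.Injective (child n p))
    (h1 : ∀ n p τ, (child n p τ).1 / s n = p.1) (h2 : ∀ n p τ, (child n p τ).2 / t n = p.2)
    (n : ℕ) (p : ℕ × ℕ) :
    cmeas M {ω | cpos child ω n = p} ≤ ((M : ENNReal)⁻¹) ^ n := by
  rcases Set.eq_empty_or_nonempty {ω | cpos child ω n = p} with h | ⟨ω0, h⟩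
  · rw [h]; simp
  · rw [← cmeas_cyl M ω0 n]
    refine measure_mono fun ω hω => ?_
    exact cpos_inj child s t hinj h1 h2 ω ω0 n (by rw [hω.out, h.out])

theorem ball_bound {M : ℕ} [NeZero M] (child : ℕ → ℕ × ℕ → Fin M → ℕ × ℕ) (A B s t : ℕ → ℕ)
    (hA0 : A 0 = 1) (hA : ∀ n, A (n + 1) = A n * s n) (hs : ∀ n, 0 < s n)
    (hB0 : B 0 = 1) (hB : ∀ n, B (n + 1) = B n * t n) (ht : ∀ n, 0 < t n)
    (hinj : ∀ n p, Function.Injective (child n p))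
    (h1 : ∀ n p τ, (child n p τ).1 / s n = p.1) (h2 : ∀ n p τ, (child n p τ).2 / t n = p.2)
    (hAB : ∀ n, A n * B n = (2 * M) ^ n)
    (S : Set (ℝ × ℝ)) (r : ℝ) (hr : 0 < r) (hS : Metric.ediam S ≤ ENNReal.ofReal r) (n : ℕ)
    (hAr : 1 ≤ A n * r) (hBr : 1 ≤ B n * r) :
    (cmeas M).map (cpi child A B) S ≤ ENNReal.ofReal (16 * r ^ 2 * 2 ^ n) := by
  rcases Set.eq_empty_or_nonempty S with rfl | ⟨z, hz⟩
  · simp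
  have hM : 0 < M := Nat.pos_of_ne_zero (NeZero.ne M)
  have hAp : (0:ℝ) < A n := by
    by_contra h
    have : (A n : ℝ) * r ≤ 0 := mul_nonpos_of_nonpos_of_nonneg (not_lt.1 h) hr.le
    linarith
  have hBp : (0:ℝ) < B n := by
    by_contra h
    have : (B n : ℝ) * r ≤ 0 := mul_nonpos_of_nonpos_of_nonneg (not_lt.1 h) hr.le
    linarith
  obtain ⟨F, hFc, hF⟩ := count_nat (A n * (z.1 - r) - 1) (2 * A n * r + 1) (by positivity)
  obtain ⟨G, hGc, hG⟩ := count_nat (B n * (z.2 - r) - 1) (2 * B n * r + 1) (by positivity)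
  have hcl : S ⊆ Metric.closedBall z r := by
    intro y hy
    rw [Metric.mem_closedBall]
    have := (Metric.edist_le_ediam_of_mem hy hz).trans hS
    rw [edist_dist] at this
    exact (ENNReal.ofReal_le_ofReal_iff hr.le).1 this
  have hsub : cpi child A B ⁻¹' (Metric.closedBall z r) ⊆
      ⋃ p ∈ F ×ˢ G, {ω | cpos child ω n = p} := by
    intro ω hω
    rw [mem_preimage, Metric.mem_closedBall, Prod.dist_eq, max_le_iff, Real.dist_eq, Real.dist_eq,
      abs_le, abs_le] at hω
    have m1 := nested_real A s (fun n => (cpos child ω n).1) hA0 hA hs (fun n => h1 n _ _) n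
    have m2 := nested_real B t (fun n => (cpos child ω n).2) hB0 hB ht (fun n => h2 n _ _) n
    simp only [cpi] at hω
    rw [mem_Icc, div_le_iff₀ hAp, le_div_iff₀ hAp] at m1
    rw [mem_Icc, div_le_iff₀ hBp, le_div_iff₀ hBp] at m2
    obtain ⟨⟨a1, a2⟩, a3, a4⟩ := hω
    refine mem_iUnion₂.2 ⟨cpos child ω n, ?_, rfl⟩
    rw [Finset.mem_product]
    constructor
    · apply hF <;> nlinarith
    · apply hG <;> nlinarith
  calc (cmeas M).map (cpi child A B) S
      ≤ (cmeas M).map (cpi child A B) (Metric.closedBall z r) := measure_mono hcl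
    _ = cmeas M (cpi child A B ⁻¹' (Metric.closedBall z r)) :=
        Measure.map_apply (cpi_measurable _ _ _) Metric.isClosed_closedBall.measurableSet
    _ ≤ cmeas M (⋃ p ∈ F ×ˢ G, {ω | cpos child ω n = p}) := measure_mono hsub
    _ ≤ ∑ p ∈ F ×ˢ G, cmeas M {ω | cpos child ω n = p} := measure_biUnion_finset_le _ _
    _ ≤ ∑ p ∈ F ×ˢ G, ((M : ENNReal)⁻¹) ^ n :=
        Finset.sum_le_sum fun p _ => cmeas_pos child s t hinj h1 h2 n p
    _ = ENNReal.ofReal ((F.card * G.card : ℝ) * ((M : ℝ)⁻¹) ^ n) := by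
        rw [Finset.sum_const, Finset.card_product, nsmul_eq_mul,
          ENNReal.ofReal_mul (by positivity), ENNReal.ofReal_pow (by positivity),
          ENNReal.ofReal_inv_of_pos (by exact_mod_cast hM), ENNReal.ofReal_natCast]
        congr 1
        rw [← Nat.cast_mul, ENNReal.ofReal_natCast]
    _ ≤ ENNReal.ofReal (16 * r ^ 2 * 2 ^ n) := by
        apply ENNReal.ofReal_le_ofReal
        have e1 : (F.card : ℝ) ≤ 4 * (A n * r) := by linarith
        have e2 : (G.card : ℝ) ≤ 4 * (B n * r) := by linarith
        have e3 : (A n * B n : ℝ) = (2 * M) ^ n := by exact_mod_cast hAB n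
        have hM' : (0:ℝ) < M := by exact_mod_cast hM
        calc (F.card * G.card : ℝ) * ((M : ℝ)⁻¹) ^ n
            ≤ ((4 * (A n * r)) * (4 * (B n * r))) * ((M : ℝ)⁻¹) ^ n := by gcongr
          _ = 16 * r ^ 2 * ((A n * B n) * ((M : ℝ)⁻¹) ^ n) := by ring
          _ = 16 * r ^ 2 * 2 ^ n := by
            rw [e3, ← mul_pow]; congr 2; field_simp

theorem cantor_dim {M : ℕ} [NeZero M] (child : ℕ → ℕ × ℕ → Fin M → ℕ × ℕ) (A B s t : ℕ → ℕ)
    (hA0 : A 0 = 1) (hA : ∀ n, A (n + 1) = A n * s n) (hs : ∀ n, 0 < s n)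
    (hB0 : B 0 = 1) (hB : ∀ n, B (n + 1) = B n * t n) (ht : ∀ n, 0 < t n)
    (hinj : ∀ n p, Function.Injective (child n p))
    (h1 : ∀ n p τ, (child n p τ).1 / s n = p.1) (h2 : ∀ n p τ, (child n p τ).2 / t n = p.2)
    (hAB : ∀ n, A n * B n = (2 * M) ^ n)
    (E : Set (ℝ × ℝ)) (hE : ∀ ω, cpi child A B ω ∈ E) (d : NNReal) (hd : 0 < d) (C : ℝ)
    (hC : 0 < C)
    (hr : ∀ r : ℝ, 0 < r → r ≤ 1 → ∃ n, 1 ≤ A n * r ∧ 1 ≤ B n * r ∧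
      r ^ 2 * 2 ^ n ≤ C * r ^ (d : ℝ)) : (d : ENNReal) ≤ dimH E := by
  set μ := (cmeas M).map (cpi child A B) with hμ
  have key : ∀ (S : Set (ℝ × ℝ)) (r : ℝ), 0 < r → r ≤ 1 → Metric.ediam S ≤ ENNReal.ofReal r →
      μ S ≤ ENNReal.ofReal (16 * C) * ENNReal.ofReal r ^ (d : ℝ) := by
    intro S r hr0 hr1 hS
    obtain ⟨n, n1, n2, n3⟩ := hr r hr0 hr1
    refine (ball_bound child A B s t hA0 hA hs hB0 hB ht hinj h1 h2 hAB S r hr0 hS n n1 n2).trans ?_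
    rw [ENNReal.ofReal_rpow_of_pos hr0, ← ENNReal.ofReal_mul (by positivity)]
    apply ENNReal.ofReal_le_ofReal
    linarith
  have key2 : ∀ S : Set (ℝ × ℝ), Metric.ediam S ≤ 1 →
      μ S ≤ ENNReal.ofReal (16 * C) * Metric.ediam S ^ (d : ℝ) := by
    intro S hS
    have hfin : Metric.ediam S ≠ ⊤ := ne_top_of_le_ne_top ENNReal.one_ne_top hS
    rcases eq_or_ne (Metric.ediam S) 0 with h0 | h0
    · rw [h0, ENNReal.zero_rpow_of_pos (by exact_mod_cast hd), mul_zero]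
      have lim : Tendsto (fun r : ℝ => ENNReal.ofReal (16 * C) * ENNReal.ofReal r ^ (d : ℝ))
          (nhdsWithin 0 (Ioi 0)) (nhds 0) := by
        have c1 : Tendsto (fun r : ℝ => ENNReal.ofReal r ^ (d : ℝ)) (nhdsWithin 0 (Ioi 0))
            (nhds (ENNReal.ofReal 0 ^ (d : ℝ))) :=
          ((ENNReal.continuous_rpow_const.comp ENNReal.continuous_ofReal).tendsto
            (0:ℝ)).mono_left nhdsWithin_le_nhds
        rw [ENNReal.ofReal_zero, ENNReal.zero_rpow_of_pos (by exact_mod_cast hd)] at c1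
        have := ENNReal.Tendsto.const_mul (a := ENNReal.ofReal (16 * C)) c1
          (Or.inr ENNReal.ofReal_ne_top)
        rwa [mul_zero] at this
      refine ge_of_tendsto lim ?_
      filter_upwards [Ioc_mem_nhdsGT (zero_lt_one (α := ℝ))] with r hr'
      exact key S r hr'.1 hr'.2 (by rw [h0]; exact zero_le)
    · have hp : 0 < (Metric.ediam S).toReal := ENNReal.toReal_pos h0 hfin
      have := key S (Metric.ediam S).toReal hp
        (ENNReal.toReal_le_of_le_ofReal zero_le_one (by simpa using hS))
        (by rw [ENNReal.ofReal_toReal hfin])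
      rwa [ENNReal.ofReal_toReal hfin] at this
  have hc0 : ENNReal.ofReal (16 * C) ≠ 0 := by
    rw [Ne, ENNReal.ofReal_eq_zero]; push Not; positivity
  have le := Measure.le_hausdorffMeasure (X := ℝ × ℝ) (d : ℝ) ((ENNReal.ofReal (16 * C))⁻¹ • μ) 1
    zero_lt_one (by
      intro S hS
      rw [Measure.smul_apply, smul_eq_mul, mul_comm, ← div_eq_mul_inv]
      exact ENNReal.div_le_of_le_mul' (key2 S hS))
  apply le_dimH_of_hausdorffMeasure_ne_zero
  intro h0
  have := le E
  rw [h0, Measure.smul_apply, smul_eq_mul, nonpos_iff_eq_zero, mul_eq_zero] at this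
  rcases this with h | h
  · exact ENNReal.inv_ne_zero.2 ENNReal.ofReal_ne_top h
  · have h3 := Measure.le_map_apply (μ := cmeas M) (cpi_measurable child A B).aemeasurable E
    rw [← hμ, h, show cpi child A B ⁻¹' E = univ from eq_univ_of_forall hE] at h3
    simp at h3

theorem nint_le_abs (y : ℝ) (m : ℤ) : nint y ≤ |y - m| := round_le y m

theorem nint_abs_mul (z : ℤ) (x : ℝ) (m : ℤ) : nint ((z.natAbs : ℝ) * x) ≤ |z * x - m| := by
  rw [Nat.cast_natAbs]
  rcases abs_choice z with h | h
  · rw [h]; exact nint_le_abs _ m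
  · rw [h]
    refine (nint_le_abs _ (-m)).trans (le_of_eq ?_)
    rw [← abs_neg]; congr 1; push_cast; ring

theorem diff_q (x g g' h : ℝ) (q q' : ℤ) (h1 : nint (q * x - g) ≤ h) (h2 : nint (q' * x - g') ≤ h) :
    nint (((q - q').natAbs : ℝ) * x) ≤ 2 * h + |g - g'| := by
  refine (nint_abs_mul (q - q') x (round (q * x - g) - round (q' * x - g'))).trans ?_
  unfold nint at h1 h2
  push_cast
  have e : ((q:ℝ) - q') * x - (round (q * x - g) - round (q' * x - g')) =
    (q * x - g - round (q * x - g)) - (q' * x - g' - round (q' * x - g')) + (g - g') := by ring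
  rw [e]
  have := abs_add_le ((q * x - g - round (q * x - g)) - (q' * x - g' - round (q' * x - g'))) (g - g')
  have := abs_sub (q * x - g - round (q * x - g)) (q' * x - g' - round (q' * x - g'))
  linarith

theorem same_q (y g g' A Y : ℝ) (u u' : ℕ) (hA : 0 < A) (hY : 8 ≤ Y) (hAY : A ≤ 2 * Y)
    (h1 : nint (y - g) ≤ Y⁻¹) (h2 : nint (y - g') ≤ Y⁻¹) (hg : |g - g'| ≤ 1 / 4)
    (hu : g ∈ Icc (u / A) ((u + 1) / A)) (hu' : g' ∈ Icc (u' / A) ((u' + 1) / A)) :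
    |(u : ℤ) - u'| ≤ 5 := by
  unfold nint at h1 h2
  have hY8 : Y⁻¹ ≤ 1 / 8 := by
    rw [← one_div]; exact one_div_le_one_div_of_le (by norm_num) hY
  rw [abs_le] at h1 h2 hg
  have hm : round (y - g) - round (y - g') = 0 := by
    have : |round (y - g) - round (y - g')| < 1 := by
      have : |((round (y - g) : ℝ) - round (y - g'))| < 1 := by
        rw [abs_lt]; constructor <;> linarith
      exact_mod_cast this
    exact Int.abs_lt_one_iff.1 this
  have hm' : (round (y - g) : ℝ) = round (y - g') := by
    have : round (y - g) = round (y - g') := by omega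
    rw [this]
  have hAY' : A * Y⁻¹ ≤ 2 := by
    have : 0 < Y := by linarith
    rw [← div_eq_mul_inv, div_le_iff₀ this]; exact hAY
  rw [mem_Icc, div_le_iff₀ hA, le_div_iff₀ hA] at hu hu'
  have k1 : (g - g') ≤ 2 * Y⁻¹ := by linarith
  have k2 : -(2 * Y⁻¹) ≤ (g - g') := by linarith
  have k3 : A * (g - g') ≤ A * (2 * Y⁻¹) := by gcongr
  have k4 : A * (-(2 * Y⁻¹)) ≤ A * (g - g') := by gcongr
  have : |(u : ℝ) - u'| ≤ 5 := by
    rw [abs_le]; constructor <;> linarith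
  exact_mod_cast this

theorem exists_children (s t M : ℕ) (hs : 0 < s) (ht : 0 < t) (hst : s * t = 2 * M) (hM : 121 ≤ M)
    (p : ℕ × ℕ) (Bd : ℕ × ℕ → Prop)
    (hB : ∀ u v : ℕ × ℕ, u.1 / s = p.1 → u.2 / t = p.2 → v.1 / s = p.1 → v.2 / t = p.2 →
      Bd u → Bd v → |(u.1 : ℤ) - v.1| ≤ 5 ∧ |(u.2 : ℤ) - v.2| ≤ 5) :
    ∃ f : Fin M → ℕ × ℕ, Function.Injective f ∧
      ∀ τ, (f τ).1 / s = p.1 ∧ (f τ).2 / t = p.2 ∧ ¬ Bd (f τ) := by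
  classical
  set Ch : Finset (ℕ × ℕ) := (Finset.range s ×ˢ Finset.range t).image
    (fun e => (p.1 * s + e.1, p.2 * t + e.2)) with hCh
  have cardCh : Ch.card = 2 * M := by
    rw [hCh, Finset.card_image_of_injective]
    · simp [hst]
    · rintro ⟨a, b⟩ ⟨c, d⟩ h
      simp only [Prod.mk.injEq] at h ⊢
      omega
  have memCh : ∀ u ∈ Ch, u.1 / s = p.1 ∧ u.2 / t = p.2 := by
    intro u hu
    rw [hCh, Finset.mem_image] at hu
    obtain ⟨e, he, rfl⟩ := hu
    rw [Finset.mem_product, Finset.mem_range, Finset.mem_range] at he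
    simp only
    constructor
    · rw [mul_comm, Nat.mul_add_div hs, Nat.div_eq_of_lt he.1, add_zero]
    · rw [mul_comm, Nat.mul_add_div ht, Nat.div_eq_of_lt he.2, add_zero]
  have cardBad : (Ch.filter Bd).card ≤ M := by
    rcases (Ch.filter Bd).eq_empty_or_nonempty with h | ⟨u, hu⟩
    · rw [h]; simp
    · rw [Finset.mem_filter] at hu
      have : (Ch.filter Bd) ⊆
          Finset.Icc (u.1 - 5) (u.1 + 5) ×ˢ Finset.Icc (u.2 - 5) (u.2 + 5) := by
        intro v hv
        rw [Finset.mem_filter] at hv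
        have := hB u v (memCh u hu.1).1 (memCh u hu.1).2 (memCh v hv.1).1 (memCh v hv.1).2 hu.2 hv.2
        rw [abs_le, abs_le] at this
        rw [Finset.mem_product, Finset.mem_Icc, Finset.mem_Icc]
        omega
      refine (Finset.card_le_card this).trans (le_trans ?_ hM)
      rw [Finset.card_product, Nat.card_Icc, Nat.card_Icc]
      calc _ ≤ 11 * 11 := Nat.mul_le_mul (by omega) (by omega)
        _ = 121 := rfl
  have cardGood : M ≤ (Ch.filter (fun u => ¬ Bd u)).card := by
    have := Finset.card_filter_add_card_filter_not (s := Ch) Bd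
    omega
  obtain ⟨G, hG, hGc⟩ := Finset.exists_subset_card_eq cardGood
  refine ⟨fun τ => (G.equivFinOfCardEq hGc).symm τ, ?_, ?_⟩
  · exact Subtype.val_injective.comp (Equiv.injective _)
  · intro τ
    have := hG ((G.equivFinOfCardEq hGc).symm τ).2
    rw [Finset.mem_filter] at this
    exact ⟨(memCh _ this.1).1, (memCh _ this.1).2, this.2⟩

/-- The dangerous cells: `T`, `T'` are the scales, `l` the constant. -/
def BadCell (i j : ℝ) (x : ℝ × ℝ) (l T T' : ℝ) (A' B' : ℕ) (u : ℕ × ℕ) : Prop :=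
  ∃ q : ℤ, q ≠ 0 ∧ |(q : ℝ)| < l * T' ∧ ∃ g1 g2 : ℝ,
    g1 ∈ Icc ((u.1 : ℝ) / A') ((u.1 + 1 : ℝ) / A') ∧
    g2 ∈ Icc ((u.2 : ℝ) / B') ((u.2 + 1 : ℝ) / B') ∧
    l * T ≤ |(q : ℝ)| ∧
    nint (q * x.1 - g1) ≤ (T' ^ i)⁻¹ ∧ nint (q * x.2 - g2) ≤ (T' ^ j)⁻¹

theorem cell_sub (A s : ℕ) (hA : 0 < A) (hs : 0 < s) (u p : ℕ) (h : u / s = p) (g : ℝ)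
    (hg : g ∈ Icc ((u : ℝ) / (A * s : ℕ)) ((u + 1 : ℝ) / (A * s : ℕ))) :
    g ∈ Icc ((p : ℝ) / A) ((p + 1 : ℝ) / A) := by
  have e1 : (0:ℝ) < A := by exact_mod_cast hA
  have e2 : (0:ℝ) < s := by exact_mod_cast hs
  have a1 := Nat.div_mul_le_self u s
  have a2 := Nat.lt_div_mul_add (a := u) hs
  rw [h] at a1 a2
  have b1 : (p * s : ℝ) ≤ u := by exact_mod_cast a1
  have b2 : (u + 1 : ℝ) ≤ p * s + s := by exact_mod_cast a2
  refine ⟨le_trans ?_ hg.1, hg.2.trans ?_⟩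
  · push_cast; rw [div_le_div_iff₀ e1 (by positivity)]; nlinarith
  · push_cast; rw [div_le_div_iff₀ (by positivity) e1]; nlinarith

theorem cell_diff (A : ℕ) (p : ℕ) (g g' : ℝ)
    (hg : g ∈ Icc ((p : ℝ) / A) ((p + 1 : ℝ) / A)) (hg' : g' ∈ Icc ((p : ℝ) / A) ((p + 1 : ℝ) / A)) :
    |g - g'| ≤ (A : ℝ)⁻¹ := by
  have : ((p + 1 : ℝ) / A) = (p : ℝ) / A + (A : ℝ)⁻¹ := by rw [add_div, one_div]
  rw [this] at hg hg'
  rw [abs_le]; constructor <;> linarith [hg.1, hg.2, hg'.1, hg'.2]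

theorem pw_bound (i T y : ℝ) (hi : 0 < i) (hT : 0 < T) (hy0 : 0 ≤ y) (hy : y ≤ 4 * (T ^ i)⁻¹) :
    pw y i ≤ 4 ^ (1 / i) / T := by
  unfold pw
  rw [if_neg hi.ne']
  calc y ^ (1 / i) ≤ (4 * (T ^ i)⁻¹) ^ (1 / i) := by
        apply Real.rpow_le_rpow hy0 hy; positivity
    _ = 4 ^ (1 / i) / T := by
        rw [Real.mul_rpow (by norm_num) (by positivity), Real.inv_rpow (by positivity),
          ← Real.rpow_mul hT.le, mul_one_div_cancel hi.ne', Real.rpow_one]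
        exact (div_eq_mul_inv _ T).symm

theorem nint_nonneg (y : ℝ) : 0 ≤ nint y := abs_nonneg _

theorem bad_close (i j : ℝ) (hi : 0 < i) (hj : 0 < j) (x : ℝ × ℝ) (c l T R : ℝ) (hc : 0 < c)
    (hx : ∀ q : ℕ, 0 < q → max (pw (nint (q * x.1)) i) (pw (nint (q * x.2)) j) > c / q)
    (hT : 0 < T) (hR : 1 ≤ R) (hl : 0 < l)
    (hl' : 2 * l * R * (4 ^ (1 / i) + 4 ^ (1 / j)) ≤ c)
    (A B s t : ℕ) (hA : 0 < A) (hB : 0 < B) (hs : 0 < s) (ht : 0 < t)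
    (hTi : 8 ≤ T ^ i) (hTj : 8 ≤ T ^ j)
    (hA1 : T ^ i ≤ 2 * A) (hB1 : T ^ j ≤ 2 * B)
    (hA2 : ((A * s : ℕ) : ℝ) ≤ 2 * (T * R) ^ i) (hB2 : ((B * t : ℕ) : ℝ) ≤ 2 * (T * R) ^ j)
    (p u v : ℕ × ℕ) (u1 : u.1 / s = p.1) (u2 : u.2 / t = p.2) (v1 : v.1 / s = p.1)
    (v2 : v.2 / t = p.2) (hu : BadCell i j x l T (T * R) (A * s) (B * t) u)
    (hv : BadCell i j x l T (T * R) (A * s) (B * t) v) :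
    |(u.1 : ℤ) - v.1| ≤ 5 ∧ |(u.2 : ℤ) - v.2| ≤ 5 := by
  obtain ⟨q, hq0, hq1, g1, g2, hg1, hg2, -, n1, n2⟩ := hu
  obtain ⟨q', hq0', hq1', g1', g2', hg1', hg2', -, n1', n2'⟩ := hv
  have d1 := cell_diff A p.1 g1 g1' (cell_sub A s hA hs _ _ u1 _ hg1)
    (cell_sub A s hA hs _ _ v1 _ hg1')
  have d2 := cell_diff B p.2 g2 g2' (cell_sub B t hB ht _ _ u2 _ hg2)
    (cell_sub B t hB ht _ _ v2 _ hg2')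
  have hAr : (0:ℝ) < A := by exact_mod_cast hA
  have hBr : (0:ℝ) < B := by exact_mod_cast hB
  have ai : (A : ℝ)⁻¹ ≤ 2 * (T ^ i)⁻¹ := by
    rw [← div_eq_mul_inv, le_div_iff₀ (by positivity), inv_mul_le_iff₀ hAr]; linarith
  have bj : (B : ℝ)⁻¹ ≤ 2 * (T ^ j)⁻¹ := by
    rw [← div_eq_mul_inv, le_div_iff₀ (by positivity), inv_mul_le_iff₀ hBr]; linarith
  have Ti : T ^ i ≤ (T * R) ^ i := Real.rpow_le_rpow hT.le (by nlinarith) hi.le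
  have Tj : T ^ j ≤ (T * R) ^ j := Real.rpow_le_rpow hT.le (by nlinarith) hj.le
  have i8 : (T ^ i)⁻¹ ≤ 1 / 8 := by
    rw [← one_div]; exact one_div_le_one_div_of_le (by norm_num) hTi
  have j8 : (T ^ j)⁻¹ ≤ 1 / 8 := by
    rw [← one_div]; exact one_div_le_one_div_of_le (by norm_num) hTj
  have hqq : q = q' := by
    by_contra hne
    have hpos : 0 < (q - q').natAbs := Int.natAbs_pos.2 (sub_ne_zero.2 hne)
    have hb := hx _ hpos
    have e1 := diff_q x.1 g1 g1' _ q q' n1 n1'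
    have e2 := diff_q x.2 g2 g2' _ q q' n2 n2'
    have Ti' : ((T * R) ^ i)⁻¹ ≤ (T ^ i)⁻¹ := inv_anti₀ (by positivity) Ti
    have Tj' : ((T * R) ^ j)⁻¹ ≤ (T ^ j)⁻¹ := inv_anti₀ (by positivity) Tj
    have f1 := pw_bound i T _ hi hT (nint_nonneg _) (e1.trans (by linarith))
    have f2 := pw_bound j T _ hj hT (nint_nonneg _) (e2.trans (by linarith))
    have pi4 : (0:ℝ) < 4 ^ (1 / i) := by positivity
    have pj4 : (0:ℝ) < 4 ^ (1 / j) := by positivity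
    have f3 : max (pw (nint ((q - q').natAbs * x.1)) i) (pw (nint ((q - q').natAbs * x.2)) j)
        ≤ (4 ^ (1 / i) + 4 ^ (1 / j)) / T := by
      refine max_le (f1.trans ?_) (f2.trans ?_)
      · gcongr; linarith
      · gcongr; linarith
    have f4 : ((q - q').natAbs : ℝ) ≤ 2 * l * (T * R) := by
      rw [Nat.cast_natAbs]; push_cast
      have := abs_sub (q : ℝ) q'
      linarith
    have hposr : (0:ℝ) < (q - q').natAbs := by exact_mod_cast hpos
    have f5 : c / (2 * l * (T * R)) ≤ c / (q - q').natAbs := by gcongr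
    have f6 := lt_of_le_of_lt f5 (lt_of_lt_of_le hb f3)
    rw [div_lt_div_iff₀ (by positivity) hT] at f6
    have : T * (2 * l * R * (4 ^ (1 / i) + 4 ^ (1 / j))) ≤ T * c := by gcongr
    nlinarith
  subst hqq
  constructor
  · exact same_q _ g1 g1' _ ((T * R) ^ i) _ _ (by exact_mod_cast Nat.mul_pos hA hs) (by linarith)
      hA2 n1 n1' (by linarith) hg1 hg1'
  · exact same_q _ g2 g2' _ ((T * R) ^ j) _ _ (by exact_mod_cast Nat.mul_pos hB ht) (by linarith)
      hB2 n2 n2' (by linarith) hg2 hg2'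

theorem exists_grid (i j : ℝ) (hi : 0 < i) (hj : 0 < j) (hij : i + j = 1) (k : ℕ) :
    ∃ A B s t : ℕ → ℕ, A 0 = 1 ∧ B 0 = 1 ∧ (∀ n, A (n + 1) = A n * s n) ∧
      (∀ n, B (n + 1) = B n * t n) ∧ (∀ n, 0 < s n) ∧ (∀ n, 0 < t n) ∧
      (∀ n, s n * t n = 2 ^ k) ∧ (∀ n, A n * B n = (2 ^ k) ^ n) ∧
      (∀ n, 0 < A n) ∧ (∀ n, 0 < B n) ∧
      (∀ n, ((2:ℝ) ^ (k * n)) ^ i ≤ 2 * A n) ∧ (∀ n, ((2:ℝ) ^ (k * n)) ^ j ≤ 2 * B n) ∧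
      (∀ n, (A n : ℝ) ≤ 2 * ((2:ℝ) ^ (k * n)) ^ i) ∧
      (∀ n, (B n : ℝ) ≤ 2 * ((2:ℝ) ^ (k * n)) ^ j) := by
  set α : ℕ → ℕ := fun n => ⌊i * (k * n : ℕ)⌋₊ with hα
  have nn : ∀ n : ℕ, (0:ℝ) ≤ i * (k * n : ℕ) := fun n => by positivity
  have f1 : ∀ n, (α n : ℝ) ≤ i * (k * n : ℕ) := fun n => Nat.floor_le (nn n)
  have f2 : ∀ n, i * (k * n : ℕ) < (α n : ℝ) + 1 := fun n => Nat.lt_floor_add_one _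
  have hle : ∀ n, α n ≤ k * n := by
    intro n
    have h0 : (0:ℝ) ≤ (k * n : ℕ) := Nat.cast_nonneg _
    have : (α n : ℝ) ≤ (k * n : ℕ) := (f1 n).trans (by nlinarith)
    exact_mod_cast this
  have mono : ∀ n, α n ≤ α (n + 1) := by
    intro n
    apply Nat.floor_mono
    have : ((k * n : ℕ) : ℝ) ≤ (k * (n + 1) : ℕ) := by
      exact_mod_cast Nat.mul_le_mul_left k (Nat.le_succ n)
    nlinarith
  have step : ∀ n, α (n + 1) ≤ α n + k := by
    intro n
    have h1 := f1 (n + 1)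
    have h2 := f2 n
    have hk : (0:ℝ) ≤ k := Nat.cast_nonneg _
    have : (α (n + 1) : ℝ) < (α n + k + 1 : ℕ) := by
      push_cast at h1 h2 ⊢
      nlinarith
    have : α (n + 1) < α n + k + 1 := by exact_mod_cast this
    omega
  have rp : ∀ (n : ℕ) (e : ℝ), ((2:ℝ) ^ (k * n)) ^ e = 2 ^ (e * (k * n : ℕ)) := by
    intro n e
    rw [← Real.rpow_natCast 2 (k * n), ← Real.rpow_mul (by norm_num), mul_comm]
  have two : ∀ y : ℝ, 2 * (2:ℝ) ^ y = 2 ^ (y + 1) := by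
    intro y; rw [Real.rpow_add (by norm_num), Real.rpow_one, mul_comm]
  have ksucc : ∀ n, k * (n + 1) = k * n + k := fun n => by ring
  have f3 : ∀ n, ((k * n - α n : ℕ) : ℝ) = (k * n : ℕ) - α n := fun n => Nat.cast_sub (hle n)
  have f4 : ∀ n : ℕ, j * (k * n : ℕ) = (k * n : ℕ) - i * (k * n : ℕ) := by
    intro n; have : j = 1 - i := by linarith
    rw [this]; ring
  have cst : ∀ m : ℕ, ((2 ^ m : ℕ) : ℝ) = (2:ℝ) ^ (m : ℝ) := by
    intro m; rw [Real.rpow_natCast]; push_cast; rfl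
  refine ⟨fun n => 2 ^ α n, fun n => 2 ^ (k * n - α n), fun n => 2 ^ (α (n + 1) - α n),
    fun n => 2 ^ (k - (α (n + 1) - α n)), ?_, ?_, ?_, ?_, ?_, ?_, ?_, ?_, ?_, ?_, ?_, ?_, ?_, ?_⟩
  · simp [hα]
  · simp
  · intro n; simp only; rw [← pow_add]; congr 1; have := mono n; omega
  · intro n; simp only; rw [← pow_add]; congr 1
    have := mono n; have := step n; have := hle n; have := hle (n + 1); have := ksucc n; omega
  · intro n; positivity
  · intro n; positivity
  · intro n; rw [← pow_add]; congr 1; have := mono n; have := step n; omega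
  · intro n; rw [← pow_add, ← pow_mul]; congr 1; have := hle n; omega
  · intro n; positivity
  · intro n; positivity
  · intro n; rw [cst, two, rp]
    exact Real.rpow_le_rpow_of_exponent_le (by norm_num) (f2 n).le
  · intro n; rw [cst, two, rp, f3, f4]
    exact Real.rpow_le_rpow_of_exponent_le (by norm_num) (by linarith [f1 n])
  · intro n; rw [cst, rp, two]
    exact Real.rpow_le_rpow_of_exponent_le (by norm_num) (by linarith [f1 n])
  · intro n; rw [cst, rp, two, f3, f4]
    exact Real.rpow_le_rpow_of_exponent_le (by norm_num) (by linarith [f2 n])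

theorem exists_level (m : ℝ) (hm : 0 < m) (k : ℕ) (hk : 0 < k) (r : ℝ) (hr : 0 < r)
    (hr1 : r ≤ 1) : ∃ n : ℕ, 2 / r ≤ ((2:ℝ) ^ (k * n)) ^ m ∧
      r ^ 2 * 2 ^ n ≤ (2 * 2 ^ (1 / (k * m))) * r ^ (2 - 1 / (k * m)) := by
  have hk' : (0:ℝ) < k := by exact_mod_cast hk
  have hkm : (0:ℝ) < k * m := by positivity
  set L := Real.logb 2 (2 / r) with hL
  have h2r : 0 < 2 / r := by positivity
  have hLe : (2:ℝ) ^ L = 2 / r := Real.rpow_logb (by norm_num) (by norm_num) h2r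
  have hL0 : 0 ≤ L := Real.logb_nonneg (by norm_num) (by rw [le_div_iff₀ hr]; linarith)
  refine ⟨⌈L / (k * m)⌉₊, ?_, ?_⟩
  · rw [← Real.rpow_natCast 2 (k * _), ← Real.rpow_mul (by norm_num), ← hLe]
    apply Real.rpow_le_rpow_of_exponent_le (by norm_num)
    have := Nat.le_ceil (L / (k * m))
    rw [div_le_iff₀ hkm] at this
    push_cast
    linarith
  · have h1 : ((⌈L / (k * m)⌉₊ : ℕ) : ℝ) ≤ L / (k * m) + 1 :=
      (Nat.ceil_lt_add_one (by positivity)).le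
    have h2 : (2:ℝ) ^ ⌈L / (k * m)⌉₊ ≤ 2 * (2 / r) ^ (1 / (k * m)) := by
      rw [← Real.rpow_natCast, ← hLe, ← Real.rpow_mul (by norm_num)]
      calc (2:ℝ) ^ ((⌈L / (k * m)⌉₊ : ℕ) : ℝ) ≤ 2 ^ (L / (k * m) + 1) :=
            Real.rpow_le_rpow_of_exponent_le (by norm_num) h1
        _ = 2 * 2 ^ (L * (1 / (k * m))) := by
            rw [Real.rpow_add (by norm_num), Real.rpow_one, mul_comm, mul_one_div]
    calc r ^ 2 * 2 ^ ⌈L / (k * m)⌉₊ ≤ r ^ 2 * (2 * (2 / r) ^ (1 / (k * m))) := by gcongr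
      _ = _ := by
        rw [Real.div_rpow (by norm_num) hr.le, Real.rpow_sub hr, Real.rpow_two]
        ring

theorem lower_dim (i j : ℝ) (hi : 0 < i) (hj : 0 < j) (hij : i + j = 1)
    (x : ℝ × ℝ) (c : ℝ) (hc : 0 < c) (hc1 : c ≤ 1)
    (hx : ∀ q : ℕ, 0 < q → max (pw (nint (q * x.1)) i) (pw (nint (q * x.2)) j) > c / q)
    (k : ℕ) (hk8 : 8 ≤ k) (hki : 3 ≤ i * k) (hkj : 3 ≤ j * k) (d : NNReal) (hd0 : 0 < d)
    (hd : (d : ℝ) = 2 - 1 / (k * min i j)) :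
    (d : ENNReal) ≤ dimH {γ : ℝ × ℝ | γ ∈ Set.Icc (0 : ℝ × ℝ) 1 ∧
      ∃ c > (0 : ℝ), ∀ q : ℤ, q ≠ 0 →
        max (pw (nint (q * x.1 - γ.1)) i) (pw (nint (q * x.2 - γ.2)) j)
          > c / |(q : ℝ)|} := by
  obtain ⟨A, B, s, t, hA0, hB0, hA, hB, hs, ht, hst, hAB, hAp, hBp, hA1, hB1, hA2, hB2⟩ :=
    exists_grid i j hi hj hij k
  set M : ℕ := 2 ^ (k - 1) with hM
  have h2M : 2 ^ k = 2 * M := by rw [hM, ← pow_succ']; congr 1; omega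
  have hM121 : 121 ≤ M := by
    calc 121 ≤ 2 ^ 7 := by norm_num
      _ ≤ 2 ^ (k - 1) := Nat.pow_le_pow_right (by norm_num) (by omega)
  have : NeZero M := ⟨by omega⟩
  set R : ℝ := 2 ^ k with hR
  have hR1 : 1 < R := one_lt_pow₀ (by norm_num) (by omega)
  set D : ℝ := 4 ^ (1 / i) + 4 ^ (1 / j) with hD
  have hD1 : 1 ≤ D := by
    have h1 : (1:ℝ) ≤ 4 ^ (1 / i) := Real.one_le_rpow (by norm_num) (by positivity)
    have h2 : (0:ℝ) < 4 ^ (1 / j) := by positivity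
    linarith
  set l : ℝ := c / (2 * R * D) with hl
  have hlp : 0 < l := by positivity
  have hlR : 2 * l * R * D = c := by rw [hl]; field_simp
  set T : ℕ → ℝ := fun n => 2 ^ (k * n) with hT
  have hT0 : T 0 = 1 := by simp [hT]
  have hTs : ∀ n, T (n + 1) = T n * R := by
    intro n; simp only [hT, hR]; rw [← pow_add]; congr 1
  have hTp : ∀ n, 0 < T n := fun n => by simp only [hT]; positivity
  have hlR1 : l * R ≤ 1 := by nlinarith [mul_pos hlp (show 0 < R by linarith)]
  have T8 : ∀ e : ℝ, 0 < e → 3 ≤ e * k → ∀ n, 1 ≤ n → 8 ≤ T n ^ e := by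
    intro e he h3 n hn
    simp only [hT]
    rw [← Real.rpow_natCast 2 (k * n), ← Real.rpow_mul (by norm_num)]
    calc (8:ℝ) = 2 ^ (3:ℝ) := by norm_num
      _ ≤ _ := by
        apply Real.rpow_le_rpow_of_exponent_le (by norm_num)
        have : (1:ℝ) ≤ n := by exact_mod_cast hn
        push_cast
        nlinarith
  have ex : ∀ (n : ℕ) (p : ℕ × ℕ), ∃ f : Fin M → ℕ × ℕ, Function.Injective f ∧
      ∀ τ, (f τ).1 / s n = p.1 ∧ (f τ).2 / t n = p.2 ∧
        ¬ BadCell i j x l (T n) (T n * R) (A n * s n) (B n * t n) (f τ) := by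
    intro n p
    refine exists_children (s n) (t n) M (hs n) (ht n) (by rw [hst, h2M]) hM121 p _ ?_
    intro u v u1 u2 v1 v2 hu hv
    rcases Nat.eq_zero_or_pos n with rfl | hn
    · exfalso
      obtain ⟨q, hq0, hq, -⟩ := hu
      rw [hT0, one_mul] at hq
      have : (1:ℝ) ≤ |(q : ℝ)| := by exact_mod_cast Int.one_le_abs hq0
      linarith
    · refine bad_close i j hi hj x c l (T n) R hc hx (hTp n) hR1.le hlp hlR.le (A n) (B n)
        (s n) (t n) (hAp n) (hBp n) (hs n) (ht n) (T8 i hi hki n hn) (T8 j hj hkj n hn)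
        (hA1 n) (hB1 n) ?_ ?_ p u v u1 u2 v1 v2 hu hv
      · rw [← hA, ← hTs]; exact hA2 _
      · rw [← hB, ← hTs]; exact hB2 _
  choose child hinj hch using ex
  have hm : 0 < min i j := lt_min hi hj
  refine cantor_dim child A B s t hA0 hA hs hB0 hB ht hinj (fun n p τ => (hch n p τ).1)
    (fun n p τ => (hch n p τ).2.1) (fun n => by rw [hAB, h2M]) _ ?_ d hd0
    (2 * 2 ^ (1 / (k * min i j))) (by positivity) ?_
  · intro ω
    have m1 := nested_real A s (fun n => (cpos child ω n).1) hA0 hA hs (fun n => (hch n _ _).1)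
    have m2 := nested_real B t (fun n => (cpos child ω n).2) hB0 hB ht (fun n => (hch n _ _).2.1)
    refine ⟨?_, l / R, by positivity, ?_⟩
    · have a1 := m1 0
      have a2 := m2 0
      simp only [cpos, hA0, hB0, Nat.cast_zero, Nat.cast_one, div_one, zero_add] at a1 a2
      exact ⟨⟨a1.1, a2.1⟩, ⟨a1.2, a2.2⟩⟩
    · intro q hq
      have hq1 : (1:ℝ) ≤ |(q : ℝ)| := by exact_mod_cast Int.one_le_abs hq
      have : ∃ n, l * T n ≤ |(q : ℝ)| ∧ |(q : ℝ)| < l * (T n * R) := by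
        obtain ⟨N, hN⟩ := pow_unbounded_of_one_lt (|(q : ℝ)| / l) hR1
        have exN : ∃ N, |(q : ℝ)| < l * T N := by
          refine ⟨N, ?_⟩
          rw [div_lt_iff₀ hlp] at hN
          simp only [hT]
          rw [pow_mul, mul_comm]; exact hN
        classical
        have h1 := Nat.find_spec exN
        have h2 : Nat.find exN ≠ 0 := by
          intro h0
          rw [h0, hT0] at h1
          nlinarith
        obtain ⟨n, hn⟩ := Nat.exists_eq_succ_of_ne_zero h2
        refine ⟨n, ?_, ?_⟩
        · exact not_lt.1 (Nat.find_min exN (m := n) (by omega))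
        · rw [← hTs]; rw [hn] at h1; exact h1
      obtain ⟨n, n1, n2⟩ := this
      by_contra hcon
      rw [gt_iff_lt, not_lt, max_le_iff] at hcon
      apply (hch n (cpos child ω n) (ω n)).2.2
      have inv : ∀ (e y : ℝ), 0 < e → 0 ≤ y → pw y e ≤ l / R / |(q : ℝ)| →
          y ≤ ((T n * R) ^ e)⁻¹ := by
        intro e y he hy h
        have hTR : 0 < T n * R := by have := hTp n; positivity
        have h' : pw y e ≤ (T n * R)⁻¹ := by
          refine h.trans ?_
          rw [div_div, div_le_iff₀ (by positivity), inv_mul_eq_div, le_div_iff₀ hTR]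
          have : 0 < R := by linarith
          nlinarith
        unfold pw at h'
        rw [if_neg he.ne'] at h'
        have h3 := Real.rpow_le_rpow (by positivity) h' he.le
        rwa [← Real.rpow_mul hy, one_div_mul_cancel he.ne', Real.rpow_one,
          Real.inv_rpow hTR.le] at h3
      refine ⟨q, hq, n2, _, _, ?_, ?_, n1, inv i _ hi (nint_nonneg _) hcon.1,
        inv j _ hj (nint_nonneg _) hcon.2⟩
      · have := m1 (n + 1)
        rw [hA] at this; exact this
      · have := m2 (n + 1)
        rw [hB] at this; exact this
  · intro r hr hr1
    obtain ⟨n, n1, n2⟩ := exists_level (min i j) hm k (by omega) r hr hr1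
    have hT1 : (1:ℝ) ≤ 2 ^ (k * n) := one_le_pow₀ (by norm_num)
    refine ⟨n, ?_, ?_, by rw [hd]; exact n2⟩
    · have : 2 / r ≤ 2 * A n :=
        n1.trans ((Real.rpow_le_rpow_of_exponent_le hT1 (min_le_left _ _)).trans (hA1 n))
      rw [div_le_iff₀ hr] at this; linarith
    · have : 2 / r ≤ 2 * B n :=
        n1.trans ((Real.rpow_le_rpow_of_exponent_le hT1 (min_le_right _ _)).trans (hB1 n))
      rw [div_le_iff₀ hr] at this; linarith

theorem stmt13 (i j : ℝ) (hi : 0 < i) (hj : 0 < j) (hij : i + j = 1)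
    (x : ℝ × ℝ) (hx : Badij i j x) :
    dimH {γ : ℝ × ℝ | γ ∈ Set.Icc (0 : ℝ × ℝ) 1 ∧
      ∃ c > (0 : ℝ), ∀ q : ℤ, q ≠ 0 →
        max (pw (nint (q * x.1 - γ.1)) i) (pw (nint (q * x.2 - γ.2)) j)
          > c / |(q : ℝ)|} = 2 := by
  apply le_antisymm
  · refine (dimH_mono (subset_univ _)).trans ?_
    rw [Real.dimH_univ_eq_finrank]
    simp
  · obtain ⟨-, c, hc, hbad⟩ := hx
    have hm : 0 < min i j := lt_min hi hj
    refine ENNReal.le_of_forall_nnreal_lt fun e he => ?_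
    have he' : (e : ℝ) < 2 := by exact_mod_cast he
    have hpos : 0 < min 1 (2 - (e : ℝ)) := lt_min one_pos (by linarith)
    obtain ⟨k, hk⟩ := exists_nat_gt (8 + 3 / min i j + 1 / (min i j * min 1 (2 - (e : ℝ))))
    have p1 : 0 < 3 / min i j := by positivity
    have p2 : 0 < 1 / (min i j * min 1 (2 - (e : ℝ))) := by positivity
    have k8 : (8:ℝ) < k := by linarith
    have k3 : 3 / min i j < k := by linarith
    have ke : 1 / (min i j * min 1 (2 - (e : ℝ))) < k := by linarith
    rw [div_lt_iff₀ hm] at k3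
    have kpos : (0:ℝ) < k := by linarith
    have ke' : 1 / (k * min i j) < min 1 (2 - (e : ℝ)) := by
      rw [div_lt_iff₀ (by positivity)] at ke ⊢
      linarith
    have ke1 := ke'.trans_le (min_le_left _ _)
    have ke2 := ke'.trans_le (min_le_right _ _)
    obtain ⟨d, hdd⟩ : ∃ d : NNReal, (d : ℝ) = 2 - 1 / (k * min i j) :=
      ⟨Real.toNNReal (2 - 1 / (k * min i j)), Real.coe_toNNReal _ (by linarith)⟩
    have hd := lower_dim i j hi hj hij x (min c 1) (lt_min hc one_pos) (min_le_right _ _)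
      (fun q hq => by
        refine lt_of_le_of_lt ?_ (hbad q hq)
        have : (0:ℝ) < q := by exact_mod_cast hq
        gcongr
        exact min_le_left _ _)
      k (by exact_mod_cast k8.le) (by nlinarith [min_le_left i j]) (by nlinarith [min_le_right i j])
      d (by rw [← NNReal.coe_pos, hdd]; linarith) hdd
    refine le_trans ?_ hd
    rw [ENNReal.coe_le_coe, ← NNReal.coe_le_coe, hdd]
    linarith
end

section
/- Fix i, j ≥ 0 with i + j = 1 and an approximating function ψ. Then for Lebesgue-almost all irrational x ∈ [0,1]², if ∑_{r=1}^∞ ψ(r) = ∞ then the set W^x_{(i,j)}(ψ) := { γ ∈ [0,1]² : max{‖q x₁ − γ₁‖^{1/i}, ‖q x₂ − γ₂‖^{1/j}} ≤ ψ(|q|) for infinitely many nonzero integers q } has 2-dimensional Lebesgue measure 1. -/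
open MeasureTheory Set Filter

open ProbabilityTheory in
/-- Second Borel-Cantelli lemma for pairwise independent events. -/
theorem bc_pairwise {Ω G : Type*} [MeasurableSpace Ω] [MeasurableSpace G] (μ : Measure Ω)
    [IsProbabilityMeasure μ] (F : ℕ → Ω → G) (hF : ∀ n, Measurable (F n))
    (B : ℕ → Set G) (hB : ∀ n, MeasurableSet (B n))
    (hind : ∀ m n, m ≠ n → IndepFun (F m) (F n) μ)
    (hdiv : ¬ Summable (fun n => μ.real (F n ⁻¹' B n))) :
    ∀ᵐ ω ∂μ, ∃ᶠ n in atTop, F n ω ∈ B n := by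
  classical
  let X : ℕ → Ω → ℝ := fun n => (fun g => (B n).indicator (fun _ => (1 : ℝ)) g) ∘ F n
  have hXm : ∀ n, Measurable (X n) := fun n =>
    ((measurable_const.indicator (hB n))).comp (hF n)
  have hX01 : ∀ n ω, X n ω ∈ Set.Icc (0 : ℝ) 1 := by
    intro n ω
    by_cases h : F n ω ∈ B n <;> simp [X, h]
  have hXL : ∀ n, MemLp (X n) 2 μ := fun n =>
    memLp_of_bounded (ae_of_all _ (hX01 n)) (hXm n).aestronglyMeasurable 2
  have hXE : ∀ n, μ[X n] = μ.real (F n ⁻¹' B n) := by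
    intro n
    have : X n = (F n ⁻¹' B n).indicator (fun _ => (1 : ℝ)) := by
      ext ω
      by_cases h : F n ω ∈ B n <;> simp [X, h]
    rw [this, integral_indicator (hF n (hB n))]
    simp
  let S : ℕ → Ω → ℝ := fun n => ∑ k ∈ Finset.range n, X k
  let m : ℕ → ℝ := fun n => ∑ k ∈ Finset.range n, μ.real (F k ⁻¹' B k)
  have hm : Tendsto m atTop atTop :=
    (not_summable_iff_tendsto_nat_atTop_of_nonneg (fun n => measureReal_nonneg)).1 hdiv
  have hSL : ∀ n, MemLp (S n) 2 μ := fun n => memLp_finsetSum' _ (fun k _ => hXL k)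
  have hSE : ∀ n, μ[S n] = m n := by
    intro n
    have h1 : ∫ ω, S n ω ∂μ = ∫ ω, ∑ k ∈ Finset.range n, X k ω ∂μ := by
      simp [S, Finset.sum_apply]
    rw [h1, integral_finsetSum _ (fun k _ => (hXL k).integrable (by norm_num))]
    exact Finset.sum_congr rfl (fun k _ => hXE k)
  have hSV : ∀ n, variance (S n) μ ≤ m n := by
    intro n
    have h1 : variance (S n) μ = ∑ k ∈ Finset.range n, variance (X k) μ := by
      apply IndepFun.variance_sum (fun k _ => hXL k)
      intro a _ b _ hab
      exact (hind a b hab).comp (measurable_const.indicator (hB a))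
        (measurable_const.indicator (hB b))
    rw [h1]
    refine Finset.sum_le_sum (fun k _ => ?_)
    have h2 := variance_le_sub_mul_sub (ae_of_all μ (hX01 k)) (hXm k).aemeasurable
    rw [hXE k] at h2
    nlinarith [sq_nonneg (μ.real (F k ⁻¹' B k))]
  have hnull : ∀ K : ℕ, μ {ω | ∀ n, S n ω ≤ K} = 0 := by
    intro K
    have hlim : Tendsto (fun n => ENNReal.ofReal (4 / m n)) atTop (nhds 0) := by
      have := (tendsto_const_nhds (x := (4 : ℝ))).div_atTop hm
      simpa using ENNReal.tendsto_ofReal this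
    refine le_antisymm (ge_of_tendsto hlim ?_) bot_le
    filter_upwards [hm.eventually_ge_atTop (2 * K + 1)] with n hn
    have hmpos : 0 < m n := by
      have : (0 : ℝ) ≤ K := Nat.cast_nonneg K
      linarith
    have hch := meas_ge_le_variance_div_sq (hSL n) (c := m n / 2) (by positivity)
    rw [hSE n] at hch
    calc μ {ω | ∀ n, S n ω ≤ K} ≤ μ {ω | m n / 2 ≤ |S n ω - m n|} := by
          apply measure_mono
          intro ω hω
          have := hω n
          simp only [Set.mem_ofPred_eq]
          rw [abs_sub_comm]
          refine le_trans ?_ (le_abs_self _)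
          linarith
      _ ≤ _ := hch
      _ ≤ _ := by
          apply ENNReal.ofReal_le_ofReal
          rw [div_le_div_iff₀ (by positivity) hmpos]
          nlinarith [hSV n]
  have hall : ∀ᵐ ω ∂μ, ∀ K : ℕ, ¬ ∀ n, S n ω ≤ K := by
    rw [ae_all_iff]
    intro K
    rw [ae_iff]
    simpa using hnull K
  filter_upwards [hall] with ω hω
  by_contra hnf
  rw [not_frequently, eventually_atTop] at hnf
  obtain ⟨N, hN⟩ := hnf
  apply hω N
  intro n
  have h1 : S n ω = ∑ k ∈ Finset.range n, X k ω := by simp [S]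
  rw [h1]
  calc ∑ k ∈ Finset.range n, X k ω
      ≤ ∑ k ∈ Finset.range n, (if k ∈ Finset.range N then (1 : ℝ) else 0) := by
        refine Finset.sum_le_sum (fun k _ => ?_)
        split_ifs with hk
        · exact (hX01 k ω).2
        · have : F k ω ∉ B k := hN k (by simpa using hk)
          simp [X, this]
    _ ≤ N := by
        rw [Finset.sum_ite_mem, Finset.sum_const, nsmul_eq_mul, mul_one]
        have := Finset.card_le_card
          (Finset.inter_subset_right : Finset.range n ∩ Finset.range N ⊆ Finset.range N)
        rw [Finset.card_range] at this
        exact_mod_cast this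

/-- The two-dimensional torus. -/
abbrev T2 := UnitAddCircle × UnitAddCircle

instance instHaarT2 : (volume : Measure T2).IsAddHaarMeasure :=
  inferInstanceAs (((volume : Measure UnitAddCircle).prod
    (volume : Measure UnitAddCircle)).IsAddHaarMeasure)

instance instProbT1 : IsProbabilityMeasure (volume : Measure UnitAddCircle) :=
  ⟨by rw [AddCircle.measure_univ]; simp⟩

instance instProbT2 : IsProbabilityMeasure (volume : Measure T2) :=
  inferInstanceAs (IsProbabilityMeasure ((volume : Measure UnitAddCircle).prod
    (volume : Measure UnitAddCircle)))

instance instProbT4 : IsProbabilityMeasure (volume : Measure (T2 × T2)) :=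
  inferInstanceAs (IsProbabilityMeasure ((volume : Measure T2).prod (volume : Measure T2)))

instance instHaarT4 : (volume : Measure (T2 × T2)).IsAddHaarMeasure :=
  Measure.prod.instIsAddHaarMeasure (volume : Measure T2) (volume : Measure T2)

/-- `(x, γ) ↦ q x - γ` as a homomorphism. -/
def homF (q : ℤ) : T2 × T2 →+ T2 :=
  AddMonoidHom.mk' (fun p => q • p.1 - p.2) (by
    intro a b
    simp only [Prod.fst_add, Prod.snd_add, smul_add]
    abel)

theorem homF_cont (q : ℤ) : Continuous (homF q) := by
  change Continuous (fun p : T2 × T2 => q • p.1 - p.2)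
  fun_prop

theorem T2_div (n : ℤ) (hn : n ≠ 0) (a : T2) : ∃ x : T2, n • x = a := by
  have key : ∀ y : UnitAddCircle, ∃ x : UnitAddCircle, n • x = y := by
    intro y
    induction y using QuotientAddGroup.induction_on with
    | H z =>
      refine ⟨((z / n : ℝ) : UnitAddCircle), ?_⟩
      have hn' : (n : ℝ) ≠ 0 := by exact_mod_cast hn
      have h2 : n • (z / n : ℝ) = z := by
        rw [zsmul_eq_mul]
        field_simp
      change ((n • (z / n : ℝ) : ℝ) : UnitAddCircle) = (z : UnitAddCircle)
      rw [h2]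
  obtain ⟨x, hx⟩ := key a.1
  obtain ⟨y, hy⟩ := key a.2
  exact ⟨(x, y), Prod.ext hx hy⟩

theorem homF_mp (q : ℤ) : MeasurePreserving (homF q) := by
  refine (homF q).measurePreserving (homF_cont q) ?_ ?_
  · intro a
    refine ⟨(0, -a), ?_⟩
    change q • (0 : T2) - -a = a
    simp
  · simp

theorem homF_pair_mp (q r : ℤ) (h : q ≠ r) :
    MeasurePreserving (fun p => (homF q p, homF r p)) := by
  refine ((homF q).prod (homF r)).measurePreserving
    ((homF_cont q).prodMk (homF_cont r)) ?_ ?_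
  · rintro ⟨a, b⟩
    obtain ⟨x, hx⟩ := T2_div (q - r) (sub_ne_zero.2 h) (a - b)
    refine ⟨(x, q • x - a), ?_⟩
    change (q • x - (q • x - a), r • x - (q • x - a)) = (a, b)
    rw [sub_smul] at hx
    refine Prod.ext ?_ ?_
    · simp
    · have : r • x = q • x - (a - b) := by rw [← hx]; abel
      simp only [this]
      abel
  · simp

theorem homF_indep (q r : ℤ) (h : q ≠ r) :
    ProbabilityTheory.IndepFun (homF q) (homF r) (volume : Measure (T2 × T2)) := by
  rw [ProbabilityTheory.indepFun_iff_map_prod_eq_prod_map_map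
    (homF_cont q).measurable.aemeasurable (homF_cont r).measurable.aemeasurable,
    (homF_pair_mp q r h).map_eq, (homF_mp q).map_eq, (homF_mp r).map_eq]
  rfl

theorem torus_mp : MeasurePreserving
    (fun x : ℝ × ℝ => ((x.1 : UnitAddCircle), (x.2 : UnitAddCircle)))
    (volume.restrict (Set.Icc (0 : ℝ × ℝ) 1)) (volume : Measure T2) := by
  have h0 : MeasurePreserving (fun x : ℝ => (x : UnitAddCircle))
      (volume.restrict (Set.Icc (0 : ℝ) 1)) volume := by
    have := UnitAddCircle.measurePreserving_mk 0
    rw [zero_add] at this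
    rwa [← restrict_Ioc_eq_restrict_Icc]
  have h1 := h0.prod h0
  have h2 : (volume.restrict (Set.Icc (0 : ℝ × ℝ) 1)) =
      (volume.restrict (Set.Icc (0 : ℝ) 1)).prod (volume.restrict (Set.Icc (0 : ℝ) 1)) := by
    rw [Measure.prod_restrict, Set.Icc_prod_Icc]
    rfl
  rw [h2]
  exact h1

theorem pw_le {y t s e : ℝ} (hy : 0 ≤ y) (ht : 0 < t) (hts : t ≤ s) (he : 0 ≤ e)
    (h : y ≤ t ^ e) : pw y e ≤ s := by
  unfold pw
  split_ifs with h0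
  · linarith
  · have he' : 0 < e := lt_of_le_of_ne he (Ne.symm h0)
    calc y ^ (1 / e) ≤ (t ^ e) ^ (1 / e) := Real.rpow_le_rpow hy h (by positivity)
      _ = t := by rw [← Real.rpow_mul ht.le, mul_one_div_cancel h0, Real.rpow_one]
      _ ≤ s := hts

theorem ball_meas {t e : ℝ} (ht : 0 < t) (ht1 : t ≤ 1) (he : 0 ≤ e) :
    ENNReal.ofReal (t ^ e) ≤
      volume (Metric.closedBall (0 : UnitAddCircle) (t ^ e)) := by
  rw [AddCircle.volume_closedBall]
  apply ENNReal.ofReal_le_ofReal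
  have h1 : t ^ e ≤ 1 := Real.rpow_le_one ht.le ht1 he
  have h2 : 0 < t ^ e := Real.rpow_pos_of_pos ht e
  exact le_min h1 (by linarith)

theorem stmt18 (i j : ℝ) (hi : 0 ≤ i) (hj : 0 ≤ j) (hij : i + j = 1)
    (ψ : ℕ → ℝ) (hpos : ∀ r, 0 < ψ r) (hanti : Antitone ψ)
    (hdiv : ¬ Summable ψ) :
    ∀ᵐ x : ℝ × ℝ ∂(volume.restrict (Set.Icc (0 : ℝ × ℝ) 1)),
      IrrVec x → volume (twistedW x i j ψ) = 1 := by
  have _ := hanti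
  let t : ℕ → ℝ := fun n => min 1 (ψ (n + 1))
  have htpos : ∀ n, 0 < t n := fun n => lt_min one_pos (hpos _)
  have ht1 : ∀ n, t n ≤ 1 := fun n => min_le_left _ _
  have htdiv : ¬ Summable t := by
    intro hs
    apply hdiv
    rw [← summable_nat_add_iff 1]
    have hev : ∀ᶠ n in atTop, t n < 1 := hs.tendsto_atTop_zero.eventually_lt_const one_pos
    refine (summable_congr_atTop ?_).1 hs
    filter_upwards [hev] with n hn
    rcases min_lt_iff.1 hn with h | h
    · exact absurd h (lt_irrefl _)
    · exact min_eq_right h.le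
  let B : ℕ → Set T2 := fun n =>
    Metric.closedBall (0 : UnitAddCircle) (t n ^ i) ×ˢ
      Metric.closedBall (0 : UnitAddCircle) (t n ^ j)
  have hB : ∀ n, MeasurableSet (B n) := fun n =>
    Metric.isClosed_closedBall.measurableSet.prod Metric.isClosed_closedBall.measurableSet
  have hBm : ∀ n, t n ≤
      (volume : Measure (T2 × T2)).real (homF ((n : ℤ) + 1) ⁻¹' B n) := by
    intro n
    rw [measureReal_def, (homF_mp _).measure_preimage (hB n).nullMeasurableSet]
    rw [← ENNReal.ofReal_le_iff_le_toReal (measure_ne_top _ _)]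
    have hv : (volume : Measure T2) (B n) =
        volume (Metric.closedBall (0 : UnitAddCircle) (t n ^ i)) *
        volume (Metric.closedBall (0 : UnitAddCircle) (t n ^ j)) := Measure.prod_prod _ _
    rw [hv]
    calc ENNReal.ofReal (t n) = ENNReal.ofReal (t n ^ i) * ENNReal.ofReal (t n ^ j) := by
          rw [← ENNReal.ofReal_mul (Real.rpow_pos_of_pos (htpos n) i).le,
            ← Real.rpow_add (htpos n), hij, Real.rpow_one]
      _ ≤ _ := mul_le_mul' (ball_meas (htpos n) (ht1 n) hi) (ball_meas (htpos n) (ht1 n) hj)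
  have hbc := bc_pairwise (volume : Measure (T2 × T2)) (fun n => homF ((n : ℤ) + 1))
    (fun n => (homF_cont _).measurable) B hB
    (fun m n hmn => homF_indep _ _ (by omega))
    (fun hs => htdiv (hs.of_nonneg_of_le (fun n => (htpos n).le) hBm))
  have hbc2 := Measure.ae_ae_of_ae_prod (μ := (volume : Measure T2))
    (ν := (volume : Measure T2)) hbc
  have hx := torus_mp.quasiMeasurePreserving.ae hbc2
  filter_upwards [hx] with x hx _
  have hg := torus_mp.quasiMeasurePreserving.ae hx
  have hcube : (volume : Measure (ℝ × ℝ)) (Set.Icc (0 : ℝ × ℝ) 1) = 1 := by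
    have := torus_mp.measure_preimage (s := Set.univ) MeasurableSet.univ.nullMeasurableSet
    simpa using this
  rw [← hcube]
  apply measure_congr
  rw [ae_restrict_iff' measurableSet_Icc] at hg
  filter_upwards [hg] with γ hγ
  apply propext
  change γ ∈ twistedW x i j ψ ↔ γ ∈ Set.Icc (0 : ℝ × ℝ) 1
  refine ⟨fun h => h.1, fun h => ⟨h, ?_⟩⟩
  have hinf := Nat.frequently_atTop_iff_infinite.1 (hγ h)
  refine (hinf.image (f := fun n : ℕ => (n : ℤ) + 1)
    (fun a _ b _ hab => by simpa using hab)).mono ?_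
  rintro _ ⟨n, hn, rfl⟩
  have e1 : ∀ u v : ℝ, nint ((((n : ℤ) + 1 : ℤ) : ℝ) * u - v) =
      ‖((n : ℤ) + 1) • (u : UnitAddCircle) - (v : UnitAddCircle)‖ := by
    intro u v
    have : ((n : ℤ) + 1) • (u : UnitAddCircle) - (v : UnitAddCircle) =
        (((((n : ℤ) + 1 : ℤ) : ℝ) * u - v : ℝ) : UnitAddCircle) := by
      rw [← zsmul_eq_mul]
      rfl
    rw [this, UnitAddCircle.norm_eq]
    rfl
  have hn' : ((n : ℤ) + 1) • (x.1 : UnitAddCircle) - (γ.1 : UnitAddCircle) ∈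
        Metric.closedBall (0 : UnitAddCircle) (t n ^ i) ∧
      ((n : ℤ) + 1) • (x.2 : UnitAddCircle) - (γ.2 : UnitAddCircle) ∈
        Metric.closedBall (0 : UnitAddCircle) (t n ^ j) := hn
  rw [mem_closedBall_zero_iff, mem_closedBall_zero_iff] at hn'
  refine ⟨by positivity, ?_⟩
  have hna : ((n : ℤ) + 1).natAbs = n + 1 := by omega
  rw [hna, e1, e1]
  exact max_le (pw_le (norm_nonneg _) (htpos n) (min_le_right _ _) hi hn'.1)
    (pw_le (norm_nonneg _) (htpos n) (min_le_right _ _) hj hn'.2)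
end
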